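/- For every u ≥ 0, Φ_p(2u) ≤ (2^p + 31)·Φ_p(u). In particular there exists a constant C > 0, independent of u, such that Φ_p(2u) ≤ C·Φ_p(u) for all u ≥ 0. -/

import Mathlib

open MeasureTheory

/-- A Lévy measure on `ℝ`. -/
def IsLevyMeasure (ν : Measure ℝ) : Prop :=
  ν {0} = 0 ∧ ∫⁻ x, ENNReal.ofReal (min 1 (x ^ 2)) ∂ν < ⊤

/-- The centering function `τ(x) = x` for `|x| ≤ 1`, `τ(x) = x/|x|` for `|x| > 1`. -/
noncomputable def tau (x : ℝ) : ℝ := if |x| ≤ 1 then x else x / |x|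

/-- `U(u) = u·a + ∫ (τ(xu) − u·τ(x)) ρ(dx)`, where `ρ = ρ⁺ − ρ⁻`. -/
noncomputable def Ufun (a : ℝ) (ρp ρm : Measure ℝ) (u : ℝ) : ℝ :=
  u * a + ((∫ x, (tau (x * u) - u * tau x) ∂ρp) - (∫ x, (tau (x * u) - u * tau x) ∂ρm))

/-- `U*(u) = sup_{|c| ≤ 1} |U(cu)|`. -/
noncomputable def Ustar (a : ℝ) (ρp ρm : Measure ℝ) (u : ℝ) : ℝ :=
  ⨆ c : {c : ℝ // |c| ≤ 1}, |Ufun a ρp ρm (c.1 * u)|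

/-- `V_p(u) = ∫ (|xu|^p·1_{|xu|>1} + |xu|²·1_{|xu|≤1}) |ρ|(dx)`, where `|ρ| = ρ⁺ + ρ⁻`. -/
noncomputable def Vp (ρp ρm : Measure ℝ) (p : ℝ) (u : ℝ) : ℝ :=
  ∫ x, (if 1 < |x * u| then |x * u| ^ p else |x * u| ^ 2) ∂(ρp + ρm)

/-- `Φ_p(u) = U*(u) + u²·σ² + V_p(u)`. -/
noncomputable def Phi (a : ℝ) (ρp ρm : Measure ℝ) (σ2 p : ℝ) (u : ℝ) : ℝ :=
  Ustar a ρp ρm u + u ^ 2 * σ2 + Vp ρp ρm p u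


theorem tau_eq_max_min (x : ℝ) : tau x = max (-1) (min 1 x) := by
  unfold tau
  split_ifs with h
  · obtain ⟨h1, h2⟩ := abs_le.1 h
    rw [min_eq_right h2, max_eq_right h1]
  · rcases lt_abs.1 (not_le.1 h) with h1 | h1
    · rw [abs_of_pos (by linarith), div_self (by linarith), min_eq_left h1.le]
      norm_num
    · rw [abs_of_neg (by linarith), div_neg, div_self (by linarith),
        min_eq_right (by linarith), max_eq_left (by linarith)]

theorem measurable_tau : Measurable tau := by
  have : tau = fun x => max (-1) (min 1 x) := funext tau_eq_max_min
  rw [this]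
  fun_prop

theorem abs_tau_le_one (x : ℝ) : |tau x| ≤ 1 := by
  rw [tau_eq_max_min, abs_le]
  exact ⟨le_max_left _ _, max_le (by norm_num) (min_le_left _ _)⟩

theorem abs_tau_sub_self_le_sq (y : ℝ) : |tau y - y| ≤ y ^ 2 := by
  rw [tau_eq_max_min, abs_le]
  rcases max_cases (-1) (min 1 y) with h | h <;> rcases min_cases 1 y with h' | h' <;>
    constructor <;> nlinarith [sq_nonneg y, sq_nonneg (y - 1), sq_nonneg (y + 1)]

theorem abs_tau_two_mul_sub_le (y : ℝ) : |tau (2 * y) - 2 * tau y| ≤ min 1 (y ^ 2) := by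
  have key : |tau (2 * y) - 2 * tau y| ≤ 1 ∧ |tau (2 * y) - 2 * tau y| ≤ y ^ 2 := by
    simp only [tau_eq_max_min, abs_le]
    rcases max_cases (-1) (min 1 y) with h | h <;> rcases min_cases 1 y with h' | h' <;>
      rcases max_cases (-1) (min 1 (2 * y)) with k | k <;>
      rcases min_cases 1 (2 * y) with k' | k' <;>
      refine ⟨⟨?_, ?_⟩, ?_, ?_⟩ <;>
      nlinarith [sq_nonneg y, sq_nonneg (y - 1), sq_nonneg (y + 1)]
  exact le_min key.1 key.2

/-- The compensated integrand of `Ufun` is dominated by a multiple of `min 1 (x ^ 2)`. -/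
theorem abs_tau_mul_sub_le (x v : ℝ) :
    |tau (x * v) - v * tau x| ≤ (1 + |v| + v ^ 2) * min 1 (x ^ 2) := by
  rcases le_or_gt |x| 1 with h | h
  · have hx : x ^ 2 ≤ 1 := (sq_le_one_iff_abs_le_one x).2 h
    have ht : tau x = x := if_pos h
    rw [ht, min_eq_right hx, mul_comm v x]
    have := abs_tau_sub_self_le_sq (x * v)
    nlinarith [mul_nonneg (abs_nonneg v) (sq_nonneg x), sq_nonneg x]
  · have hx : 1 ≤ x ^ 2 := (one_le_sq_iff_one_le_abs x).2 h.le
    rw [min_eq_left hx]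
    have h1 := abs_sub (tau (x * v)) (v * tau x)
    rw [abs_mul] at h1
    nlinarith [abs_tau_le_one (x * v), abs_tau_le_one x, abs_nonneg v, sq_nonneg v]

theorem IsLevyMeasure.integrable_min_one_sq {ν : Measure ℝ} (h : IsLevyMeasure ν) :
    Integrable (fun x : ℝ => min 1 (x ^ 2)) ν := by
  refine ⟨by fun_prop, ?_⟩
  rw [hasFiniteIntegral_iff_ofReal (ae_of_all _ fun x => by positivity)]
  exact h.2

theorem IsLevyMeasure.integrable_tau_mul_sub {ν : Measure ℝ} (h : IsLevyMeasure ν) (v : ℝ) :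
    Integrable (fun x => tau (x * v) - v * tau x) ν := by
  refine (h.integrable_min_one_sq.const_mul (1 + |v| + v ^ 2)).mono' ?_
    (ae_of_all _ fun x => abs_tau_mul_sub_le x v)
  have h1 := measurable_tau.comp (measurable_id.mul_const v)
  exact (h1.sub (measurable_tau.const_mul v)).aestronglyMeasurable

theorem bddAbove_range_abs_Ufun (a : ℝ) {ρp ρm : Measure ℝ} (hp : IsLevyMeasure ρp)
    (hm : IsLevyMeasure ρm) (u : ℝ) :
    BddAbove (Set.range fun c : {c : ℝ // |c| ≤ 1} => |Ufun a ρp ρm (c.1 * u)|) := by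
  have bound : ∀ {ν : Measure ℝ}, IsLevyMeasure ν → ∀ v : ℝ, |v| ≤ |u| →
      |∫ x, (tau (x * v) - v * tau x) ∂ν| ≤
        (1 + |u| + u ^ 2) * ∫ x, min 1 (x ^ 2) ∂ν := by
    intro ν hν v hv
    rw [← integral_const_mul, ← Real.norm_eq_abs]
    refine norm_integral_le_of_norm_le (hν.integrable_min_one_sq.const_mul _)
      (ae_of_all _ fun x => (abs_tau_mul_sub_le x v).trans ?_)
    have := sq_le_sq.2 hv
    gcongr
  refine ⟨|u| * |a| + ((1 + |u| + u ^ 2) * (∫ x, min 1 (x ^ 2) ∂ρp) +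
    (1 + |u| + u ^ 2) * ∫ x, min 1 (x ^ 2) ∂ρm), ?_⟩
  rintro _ ⟨⟨c, hc⟩, rfl⟩
  have hv : |c * u| ≤ |u| := by
    rw [abs_mul]
    exact mul_le_of_le_one_left (abs_nonneg u) hc
  refine (abs_add_le _ _).trans (add_le_add ?_ ((abs_sub _ _).trans
    (add_le_add (bound hp _ hv) (bound hm _ hv))))
  rw [abs_mul]
  gcongr

/-- The profile `|y|^p` for `|y| > 1`, `y²` for `|y| ≤ 1`, integrated in `Vp`. -/
noncomputable def powerProfile (p y : ℝ) : ℝ := if 1 < |y| then |y| ^ p else |y| ^ 2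

theorem Vp_eq_integral_powerProfile (ρp ρm : Measure ℝ) (p u : ℝ) :
    Vp ρp ρm p u = ∫ x, powerProfile p (x * u) ∂(ρp + ρm) := rfl

theorem powerProfile_nonneg (p y : ℝ) : 0 ≤ powerProfile p y := by
  unfold powerProfile
  split_ifs <;> positivity

theorem measurable_powerProfile (p : ℝ) : Measurable (powerProfile p) := by
  unfold powerProfile
  exact Measurable.ite (measurableSet_lt measurable_const (by fun_prop)) (by fun_prop)
    (by fun_prop)

theorem min_one_sq_le_powerProfile {p : ℝ} (hp0 : 0 ≤ p) (y : ℝ) :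
    min 1 (y ^ 2) ≤ powerProfile p y := by
  unfold powerProfile
  split_ifs with h
  · exact (min_le_left _ _).trans (Real.one_le_rpow h.le hp0)
  · rw [sq_abs]
    exact min_le_right _ _

theorem powerProfile_two_mul_le (p y : ℝ) :
    powerProfile p (2 * y) ≤ ((2 : ℝ) ^ p + 4) * powerProfile p y := by
  have h2p : (0 : ℝ) < 2 ^ p := by positivity
  have hy : |2 * y| = 2 * |y| := by rw [abs_mul, abs_two]
  unfold powerProfile
  rw [hy]
  rcases lt_or_ge 1 |y| with h | h
  · rw [if_pos h, if_pos (by linarith), Real.mul_rpow (by norm_num) (abs_nonneg y)]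
    have : 0 ≤ |y| ^ p := by positivity
    nlinarith
  · rw [if_neg h.not_gt]
    split_ifs with h'
    · rcases le_total 2 p with hp | hp
      · have : |y| ^ p ≤ |y| ^ (2 : ℕ) := by
          rw [← Real.rpow_natCast |y| 2]
          exact Real.rpow_le_rpow_of_exponent_ge (by linarith) h (by exact_mod_cast hp)
        rw [Real.mul_rpow (by norm_num) (abs_nonneg y)]
        nlinarith [sq_nonneg |y|]
      · have : (2 * |y|) ^ p ≤ (2 * |y|) ^ (2 : ℕ) := by
          rw [← Real.rpow_natCast (2 * |y|) 2]
          exact Real.rpow_le_rpow_of_exponent_le h'.le (by exact_mod_cast hp)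
        nlinarith [mul_nonneg h2p.le (sq_nonneg |y|)]
    · nlinarith [mul_nonneg h2p.le (sq_nonneg |y|)]

theorem powerProfile_mul_le {p : ℝ} (hp0 : 0 ≤ p) (x u : ℝ) :
    powerProfile p (x * u) ≤ (1 + u ^ 2 + |u| ^ p * u ^ 2) * min 1 (x ^ 2) +
      |u| ^ p * Set.indicator {x : ℝ | 1 < |x|} (fun x => |x| ^ p) x := by
  have hup : 0 ≤ |u| ^ p := by positivity
  unfold powerProfile
  rw [sq_abs, abs_mul]
  rcases lt_or_ge 1 |x| with hx | hx
  · have hx2 : 1 ≤ x ^ 2 := (one_le_sq_iff_one_le_abs x).2 hx.le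
    have hxp : 0 ≤ |x| ^ p := by positivity
    rw [Set.indicator_of_mem (by exact hx), min_eq_left hx2]
    have h3 := mul_nonneg hup (sq_nonneg u)
    split_ifs with h
    · rw [Real.mul_rpow (abs_nonneg x) (abs_nonneg u)]
      nlinarith [sq_nonneg u]
    · have : (x * u) ^ 2 ≤ 1 := by
        rw [sq_le_one_iff_abs_le_one, abs_mul]
        exact not_lt.1 h
      nlinarith [sq_nonneg u, mul_nonneg hup hxp]
  · have hx2 : x ^ 2 ≤ 1 := (sq_le_one_iff_abs_le_one x).2 hx
    rw [Set.indicator_of_notMem (by exact hx.not_gt), min_eq_right hx2]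
    split_ifs with h
    · rw [Real.mul_rpow (abs_nonneg x) (abs_nonneg u)]
      have h1 : |x| ^ p ≤ 1 := Real.rpow_le_one (abs_nonneg x) hx hp0
      have h2 : 1 ≤ u ^ 2 * x ^ 2 := by
        rw [← mul_pow, one_le_sq_iff_one_le_abs, mul_comm u x, abs_mul]
        exact h.le
      nlinarith [mul_le_mul_of_nonneg_left h1 hup, mul_le_mul_of_nonneg_left h2 hup,
        sq_nonneg x]
    · nlinarith [sq_nonneg x, mul_nonneg (mul_nonneg hup (sq_nonneg u)) (sq_nonneg x)]

theorem integrable_powerProfile_mul {ρp ρm : Measure ℝ} (hp : IsLevyMeasure ρp)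
    (hm : IsLevyMeasure ρm) {p : ℝ} (hp0 : 0 ≤ p)
    (hint : ∫⁻ x in {x : ℝ | 1 < |x|}, ENNReal.ofReal (|x| ^ p) ∂(ρp + ρm) < ⊤) (u : ℝ) :
    Integrable (fun x => powerProfile p (x * u)) (ρp + ρm) := by
  have hS : MeasurableSet {x : ℝ | 1 < |x|} :=
    measurableSet_lt measurable_const (by fun_prop)
  have htail : Integrable (Set.indicator {x : ℝ | 1 < |x|} fun x => |x| ^ p) (ρp + ρm) := by
    rw [integrable_indicator_iff hS]
    refine ⟨(by fun_prop : Measurable fun x : ℝ => |x| ^ p).aestronglyMeasurable, ?_⟩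
    rwa [hasFiniteIntegral_iff_ofReal (ae_of_all _ fun x => by positivity)]
  have hmin : Integrable (fun x : ℝ => min 1 (x ^ 2)) (ρp + ρm) :=
    hp.integrable_min_one_sq.add_measure hm.integrable_min_one_sq
  refine ((hmin.const_mul (1 + u ^ 2 + |u| ^ p * u ^ 2)).add (htail.const_mul (|u| ^ p))).mono'
    ((measurable_powerProfile p).comp (measurable_id.mul_const u)).aestronglyMeasurable
    (ae_of_all _ fun x => ?_)
  rw [Real.norm_of_nonneg (powerProfile_nonneg _ _)]
  exact powerProfile_mul_le hp0 x u

theorem Vp_nonneg (ρp ρm : Measure ℝ) (p u : ℝ) : 0 ≤ Vp ρp ρm p u :=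
  integral_nonneg fun x => powerProfile_nonneg p (x * u)

theorem Vp_two_mul_le {ρp ρm : Measure ℝ} (hp : IsLevyMeasure ρp)
    (hm : IsLevyMeasure ρm) {p : ℝ} (hp0 : 0 ≤ p)
    (hint : ∫⁻ x in {x : ℝ | 1 < |x|}, ENNReal.ofReal (|x| ^ p) ∂(ρp + ρm) < ⊤) (u : ℝ) :
    Vp ρp ρm p (2 * u) ≤ ((2 : ℝ) ^ p + 4) * Vp ρp ρm p u := by
  rw [Vp_eq_integral_powerProfile, Vp_eq_integral_powerProfile, ← integral_const_mul]
  refine integral_mono (integrable_powerProfile_mul hp hm hp0 hint _)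
    ((integrable_powerProfile_mul hp hm hp0 hint u).const_mul _) fun x => ?_
  rw [mul_left_comm]
  exact powerProfile_two_mul_le p (x * u)

theorem Ufun_two_mul_sub (a : ℝ) {ρp ρm : Measure ℝ} (hp : IsLevyMeasure ρp)
    (hm : IsLevyMeasure ρm) (v : ℝ) :
    Ufun a ρp ρm (2 * v) - 2 * Ufun a ρp ρm v =
      (∫ x, (tau (2 * (x * v)) - 2 * tau (x * v)) ∂ρp) -
        ∫ x, (tau (2 * (x * v)) - 2 * tau (x * v)) ∂ρm := by
  have key : ∀ {ν : Measure ℝ}, IsLevyMeasure ν →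
      ∫ x, (tau (2 * (x * v)) - 2 * tau (x * v)) ∂ν =
        (∫ x, (tau (x * (2 * v)) - 2 * v * tau x) ∂ν) -
          2 * ∫ x, (tau (x * v) - v * tau x) ∂ν := by
    intro ν hν
    rw [← integral_const_mul, ← integral_sub (hν.integrable_tau_mul_sub _)
      ((hν.integrable_tau_mul_sub v).const_mul 2)]
    congr 1 with x
    rw [mul_left_comm 2 x v]
    ring
  rw [key hp, key hm, Ufun, Ufun]
  ring

theorem Ustar_two_mul_le (a : ℝ) {ρp ρm : Measure ℝ} (hp : IsLevyMeasure ρp)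
    (hm : IsLevyMeasure ρm) {p : ℝ} (hp0 : 0 ≤ p)
    (hint : ∫⁻ x in {x : ℝ | 1 < |x|}, ENNReal.ofReal (|x| ^ p) ∂(ρp + ρm) < ⊤) (u : ℝ) :
    Ustar a ρp ρm (2 * u) ≤ 2 * Ustar a ρp ρm u + Vp ρp ρm p u := by
  have : Nonempty {c : ℝ // |c| ≤ 1} := ⟨⟨0, by simp⟩⟩
  refine ciSup_le fun c => ?_
  have hsup : |Ufun a ρp ρm (c.1 * u)| ≤ Ustar a ρp ρm u :=
    le_ciSup (bddAbove_range_abs_Ufun a hp hm u) c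
  have hI := integrable_add_measure.1 (integrable_powerProfile_mul hp hm hp0 hint u)
  have hpt : ∀ x : ℝ,
      |tau (2 * (x * (c.1 * u))) - 2 * tau (x * (c.1 * u))| ≤ powerProfile p (x * u) := by
    intro x
    refine (abs_tau_two_mul_sub_le _).trans
      (le_trans ?_ (min_one_sq_le_powerProfile hp0 (x * u)))
    have hc : c.1 ^ 2 ≤ 1 := (sq_le_one_iff_abs_le_one _).2 c.2
    refine min_le_min_left _ ?_
    rw [mul_left_comm, mul_pow]
    exact mul_le_of_le_one_left (sq_nonneg _) hc
  have hdiff : |Ufun a ρp ρm (2 * (c.1 * u)) - 2 * Ufun a ρp ρm (c.1 * u)| ≤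
      Vp ρp ρm p u := by
    rw [Ufun_two_mul_sub a hp hm, Vp_eq_integral_powerProfile, integral_add_measure hI.1 hI.2]
    refine (abs_sub _ _).trans ?_
    simp only [← Real.norm_eq_abs] at hpt ⊢
    exact add_le_add (norm_integral_le_of_norm_le hI.1 (ae_of_all _ hpt))
      (norm_integral_le_of_norm_le hI.2 (ae_of_all _ hpt))
  rw [mul_left_comm]
  have htri := abs_sub_abs_le_abs_sub (Ufun a ρp ρm (2 * (c.1 * u)))
    (2 * Ufun a ρp ρm (c.1 * u))
  rw [abs_mul, abs_two] at htri
  linarith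

theorem Ustar_nonneg (a : ℝ) (ρp ρm : Measure ℝ) (u : ℝ) : 0 ≤ Ustar a ρp ρm u :=
  Real.iSup_nonneg fun _ => abs_nonneg _

/-- For every `u ≥ 0`, `Φ_p(2u) ≤ (2^p + 31)·Φ_p(u)`; in particular there is a constant
`C > 0` with `Φ_p(2u) ≤ C·Φ_p(u)` for all `u ≥ 0`. -/
theorem Phi_doubling (a : ℝ) (ρp ρm : Measure ℝ)
    (hp : IsLevyMeasure ρp) (hm : IsLevyMeasure ρm) (hsing : ρp ⟂ₘ ρm)
    (p : ℝ) (hp0 : 0 ≤ p)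
    (hint : ∫⁻ x in {x : ℝ | 1 < |x|}, ENNReal.ofReal (|x| ^ p) ∂(ρp + ρm) < ⊤)
    (σ2 : ℝ) (hσ2 : 0 ≤ σ2) :
    (∀ u : ℝ, 0 ≤ u → Phi a ρp ρm σ2 p (2 * u) ≤ ((2 : ℝ) ^ p + 31) * Phi a ρp ρm σ2 p u) ∧
    ∃ C > (0 : ℝ), ∀ u : ℝ, 0 ≤ u →
      Phi a ρp ρm σ2 p (2 * u) ≤ C * Phi a ρp ρm σ2 p u := by
  have main : ∀ u : ℝ, 0 ≤ u →
      Phi a ρp ρm σ2 p (2 * u) ≤ ((2 : ℝ) ^ p + 31) * Phi a ρp ρm σ2 p u := by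
    intro u _
    have h2p : (0 : ℝ) ≤ 2 ^ p := by positivity
    have hU := Ustar_two_mul_le a hp hm hp0 hint u
    have hV := Vp_two_mul_le hp hm hp0 hint u
    have hV0 := Vp_nonneg ρp ρm p u
    have hU0 := Ustar_nonneg a ρp ρm u
    have hs0 : 0 ≤ u ^ 2 * σ2 := by positivity
    unfold Phi
    nlinarith [mul_nonneg h2p hU0, mul_nonneg h2p hs0, mul_nonneg h2p hV0]
  exact ⟨main, (2 : ℝ) ^ p + 31, by positivity, main⟩
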